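/- There exist points p_1, p_2, q, r, s_1, …, s_8 ∈ ℂ² such that the only polynomial f ∈ ℂ[x,y] of total degree at most 21 that vanishes at p_1 and p_2, vanishes to order at least 3 at q, to order at least 6 at r, and to order at least 7 at each s_i is the zero polynomial. (The linear system L_21(1^2, 3, 6, 7^8) is empty and non-special; note C(23,2) = 2 + C(4,2) + C(7,2) + 8·C(8,2) = 253.) -/

import Mathlib

open MvPolynomial

/-- The ideal of polynomials in `ℂ[x,y]` vanishing at the point `p ∈ ℂ²`;
`f` vanishes to order at least `m` at `p` iff `f ∈ (ptIdeal p) ^ m`. -/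
noncomputable def ptIdeal (p : ℂ × ℂ) : Ideal (MvPolynomial (Fin 2) ℂ) :=
  Ideal.span {X 0 - C p.1, X 1 - C p.2}

namespace FatPoints

/-! ### Vanishing jets at a fat point -/

/-- The Taylor expansion at `(x, y)`, with the first variable as inner variable. -/
noncomputable def taylorAt (x y : ℂ) : MvPolynomial (Fin 2) ℂ →ₐ[ℂ] Polynomial (Polynomial ℂ) :=
  aeval ![Polynomial.C (Polynomial.X + Polynomial.C x),
    Polynomial.X + Polynomial.C (Polynomial.C y)]

theorem coeff_coeff_eq_zero_of_mem_pow (m : ℕ) (g : Polynomial (Polynomial ℂ))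
    (hg : g ∈ Ideal.span {Polynomial.C Polynomial.X, Polynomial.X} ^ m) (a b : ℕ)
    (hab : a + b < m) :
    (g.coeff b).coeff a = 0 := by
  induction m generalizing g a b with
  | zero => omega
  | succ m ih =>
    rw [Submodule.pow_succ] at hg
    induction hg using Submodule.mul_induction_on' with
    | mem_mul_mem g hg h hh =>
      obtain ⟨u, w, rfl⟩ := Ideal.mem_span_pair.mp hh
      have hX : ((g * (u * Polynomial.C Polynomial.X)).coeff b).coeff a = 0 := by
        rw [← mul_assoc, Polynomial.coeff_mul_C]
        cases a with
        | zero => simp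
        | succ a =>
          rw [Polynomial.coeff_mul_X]
          exact ih _ (Ideal.mul_mem_right _ _ hg) a b (by omega)
      have hY : ((g * (w * Polynomial.X)).coeff b).coeff a = 0 := by
        rw [← mul_assoc]
        cases b with
        | zero => simp
        | succ b =>
          rw [Polynomial.coeff_mul_X]
          exact ih _ (Ideal.mul_mem_right _ _ hg) a b (by omega)
      rw [mul_add, Polynomial.coeff_add, Polynomial.coeff_add, hX, hY, add_zero]
    | add g _ h _ hg hh => rw [Polynomial.coeff_add, Polynomial.coeff_add, hg, hh, add_zero]

theorem taylorAt_mem_pow {x y : ℂ} {m : ℕ} {f : MvPolynomial (Fin 2) ℂ}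
    (hf : f ∈ ptIdeal (x, y) ^ m) :
    taylorAt x y f ∈ Ideal.span {Polynomial.C Polynomial.X, Polynomial.X} ^ m := by
  have h := Ideal.mem_map_of_mem (taylorAt x y) hf
  have hX : taylorAt x y (X 0 - C x) = Polynomial.C Polynomial.X := by
    simp [taylorAt, Polynomial.algebraMap_apply]
  have hY : taylorAt x y (X 1 - C y) = Polynomial.X := by
    simp [taylorAt, Polynomial.algebraMap_apply]
  rw [Ideal.map_pow, ptIdeal, Ideal.map_span, Set.image_pair, hX, hY] at h
  exact h

/-- The exponent vector of the monomial `x ^ e.1 * y ^ e.2`. -/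
noncomputable def expVec (e : ℕ × ℕ) : Fin 2 →₀ ℕ :=
  Finsupp.single 0 e.1 + Finsupp.single 1 e.2

theorem coeff_coeff_taylorAt_monomial (x y c : ℂ) (e : ℕ × ℕ) (a b : ℕ) :
    ((taylorAt x y (monomial (expVec e) c)).coeff b).coeff a =
      c * (e.1.choose a * x ^ (e.1 - a) * (e.2.choose b * y ^ (e.2 - b))) := by
  have h : taylorAt x y (monomial (expVec e) c) =
      Polynomial.C (Polynomial.C c * (Polynomial.X + Polynomial.C x) ^ e.1) *
        (Polynomial.X + Polynomial.C (Polynomial.C y)) ^ e.2 := by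
    rw [taylorAt, aeval_monomial, expVec, Finsupp.prod_add_index' (by simp) (by simp [pow_add]),
      Finsupp.prod_single_index (by simp), Finsupp.prod_single_index (by simp)]
    simp [mul_assoc, Polynomial.algebraMap_apply]
  rw [h, Polynomial.coeff_C_mul, Polynomial.coeff_X_add_C_pow, ← Polynomial.C_pow,
    ← Polynomial.C_eq_natCast, ← mul_assoc, Polynomial.coeff_mul_C, Polynomial.coeff_mul_C,
    mul_assoc, mul_assoc, Polynomial.coeff_C_mul, Polynomial.coeff_X_add_C_pow]
  ring

/-! ### Gaussian elimination modulo a prime, on rows packed into natural numbers -/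

/-- Equal to `f n`; its kernel evaluation reduces `n` to a numeral first. -/
def force {α : Type} (n : ℕ) (f : ℕ → α) : α :=
  Nat.rec (f 0) (fun k _ => f (Nat.succ k)) n

theorem force_eq {α : Type} (n : ℕ) (f : ℕ → α) : force n f = f n := by
  cases n <;> rfl

/-- The base in which rows are packed: the `j`-th digit is the `j`-th entry. -/
def base : ℕ := 4294967296

theorem base_pos : 0 < base := by decide

/-- Multiply the first `n` entries of a packed row by `s`, and reduce them modulo `p`. -/
def scaleRow (p s n : ℕ) : ℕ → ℕ :=
  Nat.rec (fun _ => 0) (fun _ ih R => Nat.add (Nat.mod (Nat.mul (Nat.mod R base) s) p)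
    (Nat.mul base (force (Nat.div R base) ih))) n

/-- Clear the first entry of `R` modulo `p` with the row `P`, whose first entry is one, and drop
that entry. -/
def clearHead (p P R : ℕ) : ℕ :=
  Nat.div (Nat.add R (Nat.mul (Nat.sub p (Nat.mod (Nat.mod R base) p)) P)) base

/-- Apply `clearHead` to every row. -/
def clearHeads (p P : ℕ) (rows : List ℕ) : List ℕ :=
  List.rec [] (fun R _ ih => force (clearHead p P R) fun R' => R' :: ih) rows

/-- Whether Gaussian elimination modulo `p` without row exchanges succeeds for `n` steps. -/
def eliminates (p : ℕ) : ℕ → List ℕ → Bool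
  | 0, _ => true
  | _ + 1, [] => false
  | n + 1, R :: Rs =>
    force R fun R => force (scaleRow p (Nat.pow (R % base) (p - 2) % p) (n + 1) R) fun P =>
      (P % base == 1) && eliminates p n (clearHeads p P Rs)

theorem clearHeads_eq_map (p P : ℕ) (rows : List ℕ) :
    clearHeads p P rows = rows.map (clearHead p P) := by
  induction rows with
  | nil => rfl
  | cons R Rs ih =>
    have h : clearHeads p P (R :: Rs) =
      force (clearHead p P R) fun R' => R' :: clearHeads p P Rs := rfl
    rw [h, force_eq, ih, List.map_cons]

/-- The number with digits `d 0, …, d (n - 1)`. -/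
def ofDigitFun (n : ℕ) (d : ℕ → ℕ) : ℕ := ∑ j ∈ Finset.range n, d j * base ^ j

theorem ofDigitFun_succ (n : ℕ) (d : ℕ → ℕ) :
    ofDigitFun (n + 1) d = d 0 + base * ofDigitFun n (fun j => d (j + 1)) := by
  rw [ofDigitFun, ofDigitFun, Finset.sum_range_succ', Finset.mul_sum, pow_zero, mul_one, add_comm]
  congr 1
  exact Finset.sum_congr rfl fun j _ => by ring

theorem ofDigitFun_succ_mod (n : ℕ) (d : ℕ → ℕ) (h : d 0 < base) :
    ofDigitFun (n + 1) d % base = d 0 := by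
  rw [ofDigitFun_succ, Nat.add_mul_mod_self_left, Nat.mod_eq_of_lt h]

theorem ofDigitFun_succ_div (n : ℕ) (d : ℕ → ℕ) (h : d 0 < base) :
    ofDigitFun (n + 1) d / base = ofDigitFun n fun j => d (j + 1) := by
  rw [ofDigitFun_succ, Nat.add_mul_div_left _ _ base_pos, Nat.div_eq_of_lt h, zero_add]

theorem ofDigitFun_add_mul (n c : ℕ) (d e : ℕ → ℕ) :
    ofDigitFun n d + c * ofDigitFun n e = ofDigitFun n fun j => d j + c * e j := by
  simp only [ofDigitFun, Finset.mul_sum, ← Finset.sum_add_distrib]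
  exact Finset.sum_congr rfl fun j _ => by ring

theorem scaleRow_ofDigitFun (p s n : ℕ) (d : ℕ → ℕ) (h : ∀ j, d j < base) :
    scaleRow p s n (ofDigitFun n d) = ofDigitFun n fun j => d j * s % p := by
  induction n generalizing d with
  | zero => rfl
  | succ n ih =>
    have hs : ∀ R, scaleRow p s (n + 1) R =
      R % base * s % p + base * force (R / base) (scaleRow p s n) := fun _ => rfl
    rw [hs, force_eq, ofDigitFun_succ_mod _ _ (h 0), ofDigitFun_succ_div _ _ (h 0),
      ih _ fun j => h (j + 1), ofDigitFun_succ]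

/-- The packed row `R` has `n` entries, bounded by `bound`, and annihilates `v` modulo `p`. -/
def Annihilates (p bound n R : ℕ) (v : ℕ → ZMod p) : Prop :=
  ∃ d : ℕ → ℕ, (∀ j, d j ≤ bound) ∧ R = ofDigitFun n d ∧
    ∑ j ∈ Finset.range n, (d j : ZMod p) * v j = 0

theorem Annihilates.scaleRow {p bound n R : ℕ} {v : ℕ → ZMod p} (h : Annihilates p bound n R v)
    (hp : 0 < p) (hb : bound < base) (s : ℕ) : Annihilates p p n (scaleRow p s n R) v := by
  obtain ⟨d, hd, rfl, hv⟩ := h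
  refine ⟨fun j => d j * s % p, fun j => (Nat.mod_lt _ hp).le,
    scaleRow_ofDigitFun _ _ _ _ fun j => (hd j).trans_lt hb, ?_⟩
  have : ∑ j ∈ Finset.range n, ((d j * s % p : ℕ) : ZMod p) * v j =
      s * ∑ j ∈ Finset.range n, (d j : ZMod p) * v j := by
    rw [Finset.mul_sum]
    exact Finset.sum_congr rfl fun j _ => by rw [ZMod.natCast_mod]; push_cast; ring
  rw [this, hv, mul_zero]

theorem Annihilates.clearHead {p bound n R P : ℕ} {v : ℕ → ZMod p}
    (hR : Annihilates p bound (n + 1) R v) (hP : Annihilates p p (n + 1) P v)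
    (hP1 : P % base = 1) (hp : 0 < p) (hb : bound + p ^ 2 < base) :
    Annihilates p (bound + p ^ 2) n (clearHead p P R) fun j => v (j + 1) := by
  obtain ⟨d, hd, rfl, hdv⟩ := hR
  obtain ⟨e, he, rfl, hev⟩ := hP
  have hpb : p < base := by nlinarith
  have he0 : e 0 = 1 := by rw [← hP1, ofDigitFun_succ_mod _ _ ((he 0).trans_lt hpb)]
  set c := p - d 0 % p with hc
  have hcp : c ≤ p := Nat.sub_le _ _
  have hbound : ∀ j, d j + c * e j ≤ bound + p ^ 2 := fun j => by
    rw [sq]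
    exact add_le_add (hd j) (Nat.mul_le_mul hcp (he j))
  refine ⟨fun j => d (j + 1) + c * e (j + 1), fun j => hbound _, ?_, ?_⟩
  · have h : FatPoints.clearHead p (ofDigitFun (n + 1) e) (ofDigitFun (n + 1) d) =
        (ofDigitFun (n + 1) d + (p - ofDigitFun (n + 1) d % base % p) *
          ofDigitFun (n + 1) e) / base := rfl
    rw [h, ofDigitFun_succ_mod _ _ (by have := hd 0; omega), ← hc, ofDigitFun_add_mul,
      ofDigitFun_succ_div _ _ ((hbound 0).trans_lt hb)]
  · have hc0 : (d 0 : ZMod p) + c = 0 := by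
      rw [hc, Nat.cast_sub (Nat.mod_lt _ hp).le, ZMod.natCast_mod, ZMod.natCast_self]
      ring
    rw [Finset.sum_range_succ'] at hdv hev
    rw [he0] at hev
    have : ∑ j ∈ Finset.range n, ((d (j + 1) + c * e (j + 1) : ℕ) : ZMod p) * v (j + 1) =
        ∑ j ∈ Finset.range n, (d (j + 1) : ZMod p) * v (j + 1) +
          c * ∑ j ∈ Finset.range n, (e (j + 1) : ZMod p) * v (j + 1) := by
      rw [Finset.mul_sum, ← Finset.sum_add_distrib]
      exact Finset.sum_congr rfl fun j _ => by push_cast; ring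
    rw [this]
    push_cast at hev
    linear_combination hdv + (c : ZMod p) * hev - v 0 * hc0

theorem eq_zero_of_eliminates {p : ℕ} (hp : 0 < p) (n bound : ℕ) (v : ℕ → ZMod p) (rows : List ℕ)
    (hb : bound + n * p ^ 2 < base) (hrows : ∀ R ∈ rows, Annihilates p bound n R v)
    (h : eliminates p n rows = true) : ∀ j < n, v j = 0 := by
  induction n generalizing bound v rows with
  | zero => intro j hj; omega
  | succ n ih =>
    cases rows with
    | nil => simp [eliminates] at h
    | cons R Rs =>
      simp only [eliminates, force_eq, Bool.and_eq_true, beq_iff_eq] at h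
      obtain ⟨hP1, h⟩ := h
      rw [add_mul, one_mul] at hb
      have hP := (hrows R List.mem_cons_self).scaleRow hp (by omega)
        (Nat.pow (R % base) (p - 2) % p)
      rw [clearHeads_eq_map] at h
      have hv := ih (bound + p ^ 2) (fun j => v (j + 1)) _ (by omega) (by
        intro R' hR'
        obtain ⟨R₀, hR₀, rfl⟩ := List.mem_map.mp hR'
        exact (hrows R₀ (List.mem_cons_of_mem _ hR₀)).clearHead hP hP1 hp (by nlinarith)) h
      obtain ⟨e, he, heP, hev⟩ := hP
      rw [heP, ofDigitFun_succ_mod _ _ ((he 0).trans_lt (by nlinarith))] at hP1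
      rw [Finset.sum_range_succ', hP1,
        Finset.sum_eq_zero fun j hj => by rw [hv j (Finset.mem_range.mp hj), mul_zero]] at hev
      intro j hj
      cases j with
      | zero => simpa using hev
      | succ j => exact hv j (by omega)

theorem mulVec_eq_zero_of_zmod {p n : ℕ} [Fact p.Prime] (M : Matrix (Fin n) (Fin n) ℤ)
    (h : ∀ v : Fin n → ZMod p, (M.map (Int.cast : ℤ → ZMod p)).mulVec v = 0 → v = 0)
    (v : Fin n → ℂ) (hv : (M.map (Int.cast : ℤ → ℂ)).mulVec v = 0) : v = 0 := by
  by_contra hne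
  have hdet := Matrix.exists_mulVec_eq_zero_iff.mp ⟨v, hne, hv⟩
  have hdet0 : M.det = 0 := by
    have : ((M.det : ℤ) : ℂ) = 0 := by rw [Int.cast_det]; exact hdet
    exact_mod_cast this
  obtain ⟨w, hw, hMw⟩ := (Matrix.exists_mulVec_eq_zero_iff
    (M := M.map (Int.cast : ℤ → ZMod p))).mpr (by
      have := Int.cast_det (R := ZMod p) M
      rw [hdet0, Int.cast_zero] at this
      exact this.symm)
  exact hw (h w hMw)

/-! ### The system of linear conditions -/

/-- A point with natural coordinates and a multiplicity. -/
structure FatPoint where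
  x : ℕ
  y : ℕ
  mult : ℕ

/-- The partial derivative of order `(a, b)` at the point `(x, y)`. -/
structure Jet where
  x : ℕ
  y : ℕ
  a : ℕ
  b : ℕ

/-- The value of the jet `c` on the monomial with exponents `e`. -/
def Jet.entry (c : Jet) (e : ℕ × ℕ) : ℕ :=
  e.1.descFactorial c.a * Nat.pow c.x (e.1 - c.a) *
    (e.2.descFactorial c.b * Nat.pow c.y (e.2 - c.b))

theorem Jet.cast_entry (c : Jet) (e : ℕ × ℕ) :
    (c.entry e : ℂ) = c.a.factorial * c.b.factorial *
      (e.1.choose c.a * (c.x : ℂ) ^ (e.1 - c.a) * (e.2.choose c.b * (c.y : ℂ) ^ (e.2 - c.b))) := by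
  rw [Jet.entry, Nat.descFactorial_eq_factorial_mul_choose,
    Nat.descFactorial_eq_factorial_mul_choose, Nat.pow_eq, Nat.pow_eq]
  push_cast
  ring

/-- The exponents of the monomials of degree at most `21`, by increasing degree. -/
def exponents : List (ℕ × ℕ) :=
  (List.range 22).flatMap fun d => (List.range (d + 1)).map fun i => (i, d - i)

theorem mem_exponents {e : ℕ × ℕ} : e ∈ exponents ↔ e.1 + e.2 ≤ 21 := by
  obtain ⟨i, j⟩ := e
  simp only [exponents, List.mem_flatMap, List.mem_range, List.mem_map, Prod.mk.injEq]
  constructor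
  · rintro ⟨d, hd, k, hk, rfl, rfl⟩
    omega
  · exact fun h => ⟨i + j, by omega, i, by omega, rfl, by omega⟩

theorem nodup_exponents : exponents.Nodup := by
  refine List.nodup_flatMap.mpr ⟨fun d _ => ?_, ?_⟩
  · exact List.nodup_range.map fun i j h => (Prod.ext_iff.mp h).1
  · refine List.nodup_range.imp_of_mem fun {d d'} _ _ hne => ?_
    intro e he he'
    simp only [List.mem_map, List.mem_range] at he he'
    obtain ⟨i, hi, rfl⟩ := he
    obtain ⟨j, hj, h⟩ := he'
    rw [Prod.mk.injEq] at h
    omega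

theorem expVec_injective : Function.Injective expVec := fun e e' h => by
  have h0 := DFunLike.congr_fun h 0
  have h1 := DFunLike.congr_fun h 1
  simp [expVec] at h0 h1
  exact Prod.ext h0 h1

theorem expVec_apply (s : Fin 2 →₀ ℕ) : expVec (s 0, s 1) = s := by
  ext i
  fin_cases i <;> simp [expVec]

theorem eq_sum_monomial {f : MvPolynomial (Fin 2) ℂ} (hf : f.totalDegree ≤ 21) :
    f = (exponents.map fun e => monomial (expVec e) (coeff (expVec e) f)).sum := by
  classical
  rw [← List.sum_toFinset _ nodup_exponents,
    ← Finset.sum_image (f := fun s => monomial s (coeff s f)) expVec_injective.injOn]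
  conv_lhs => rw [f.as_sum]
  refine Finset.sum_subset (fun s hs => ?_) fun s _ hs => ?_
  · refine Finset.mem_image.mpr ⟨(s 0, s 1), ?_, expVec_apply s⟩
    rw [List.mem_toFinset, mem_exponents]
    have := (le_totalDegree hs).trans hf
    rwa [Finsupp.sum_fintype _ _ fun _ => rfl, Fin.sum_univ_two] at this
  · rw [notMem_support_iff.mp hs, map_zero]

theorem sum_entry_mul_coeff {f : MvPolynomial (Fin 2) ℂ} (hdeg : f.totalDegree ≤ 21) (c : Jet)
    {m : ℕ} (hf : f ∈ ptIdeal (c.x, c.y) ^ m) (hm : c.a + c.b < m) :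
    (exponents.map fun e => (c.entry e : ℂ) * coeff (expVec e) f).sum = 0 := by
  have h := coeff_coeff_eq_zero_of_mem_pow m _ (taylorAt_mem_pow hf) c.a c.b hm
  let φ : MvPolynomial (Fin 2) ℂ →+ ℂ := (Polynomial.lcoeff ℂ c.a).toAddMonoidHom.comp
    ((Polynomial.lcoeff (Polynomial ℂ) c.b).toAddMonoidHom.comp
      (taylorAt c.x c.y).toLinearMap.toAddMonoidHom)
  have hφ : ∀ g, φ g = ((taylorAt c.x c.y g).coeff c.b).coeff c.a := fun _ => rfl
  rw [← hφ, eq_sum_monomial hdeg, map_list_sum, List.map_map] at h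
  simp only [Function.comp_def, hφ, coeff_coeff_taylorAt_monomial] at h
  have := congrArg ((c.a.factorial * c.b.factorial : ℂ) * ·) h
  simp only [← List.sum_map_mul_left, mul_zero] at this
  rw [← this]
  congr 2
  funext e
  rw [Jet.cast_entry]
  ring

/-- The values of the jet `c` on the given monomials, reduced modulo `p` and packed. -/
def packRow (p : ℕ) (c : Jet) : List (ℕ × ℕ) → ℕ
  | [] => 0
  | e :: es => c.entry e % p + base * packRow p c es

theorem packRow_eq (p : ℕ) (c : Jet) (es : List (ℕ × ℕ)) :
    packRow p c es = ofDigitFun es.length fun j => c.entry (es.getD j 0) % p := by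
  induction es with
  | nil => rfl
  | cons e es ih => rw [packRow, ih, List.length_cons, ofDigitFun_succ]; rfl

theorem annihilates_packRow {p : ℕ} (hp : 0 < p) (c : Jet) (es : List (ℕ × ℕ)) (v : ℕ → ZMod p)
    (h : ∑ j : Fin es.length, (c.entry es[j] : ZMod p) * v j = 0) :
    Annihilates p p es.length (packRow p c es) v := by
  refine ⟨_, fun j => (Nat.mod_lt _ hp).le, packRow_eq p c es, ?_⟩
  rw [← h, Finset.sum_range]
  refine Finset.sum_congr rfl fun j _ => ?_
  rw [ZMod.natCast_mod, List.getD_eq_getElem _ _ j.2]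
  rfl

theorem coeff_eq_zero_of_eliminates {p : ℕ} [Fact p.Prime] (jets : List Jet)
    (es : List (ℕ × ℕ)) (hlen : es.length = jets.length) (hb : p + es.length * p ^ 2 < base)
    (helim : eliminates p es.length (jets.map fun c => packRow p c es) = true)
    (u : ℕ × ℕ → ℂ) (hu : ∀ c ∈ jets, (es.map fun e => (c.entry e : ℂ) * u e).sum = 0) :
    ∀ e ∈ es, u e = 0 := by
  have hp : 0 < p := (Fact.out : p.Prime).pos
  let M : Matrix (Fin es.length) (Fin es.length) ℤ :=
    Matrix.of fun i j => ((jets[Fin.cast hlen i].entry es[j] : ℕ) : ℤ)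
  have hv := mulVec_eq_zero_of_zmod (p := p) M (fun w hw => by
    let v : ℕ → ZMod p := fun j => if h : j < es.length then w ⟨j, h⟩ else 0
    have hvw : ∀ j : Fin es.length, v j = w j := fun j => by simp [v]
    have := eq_zero_of_eliminates hp es.length p v _ hb (fun R hR => by
      obtain ⟨c, hc, rfl⟩ := List.mem_map.mp hR
      refine annihilates_packRow hp c es v ?_
      obtain ⟨i, hi, rfl⟩ := List.getElem_of_mem hc
      have := congrFun hw ⟨i, hlen ▸ hi⟩
      simpa [Matrix.mulVec, dotProduct, M, hvw] using this) helim
    funext j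
    rw [← hvw j, this j j.2, Pi.zero_apply]) (fun j => u es[j]) (by
      funext i
      have := hu jets[Fin.cast hlen i] (List.getElem_mem _)
      rw [← Fin.sum_univ_fun_getElem] at this
      simpa [Matrix.mulVec, dotProduct, M] using this)
  intro e he
  obtain ⟨j, hj, rfl⟩ := List.getElem_of_mem he
  exact congrFun hv ⟨j, hj⟩

/-- Points imposing independent conditions on curves of degree `21`. -/
def fatPoints : List FatPoint :=
  [⟨6, 20, 7⟩, ⟨5, 9, 7⟩, ⟨4, 14, 7⟩, ⟨12, 2, 7⟩, ⟨20, 13, 7⟩, ⟨9, 10, 7⟩, ⟨17, 4, 7⟩,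
    ⟨14, 1, 7⟩, ⟨3, 2, 6⟩, ⟨3, 17, 3⟩, ⟨11, 14, 1⟩, ⟨7, 5, 1⟩]

/-- All jets vanishing on the fat points, by increasing order. -/
def fatPointJets : List Jet :=
  (List.range 7).flatMap fun t => fatPoints.flatMap fun P =>
    if t < P.mult then (List.range (t + 1)).map fun a => ⟨P.x, P.y, a, t - a⟩ else []

theorem exists_fatPoint_of_mem {c : Jet} (hc : c ∈ fatPointJets) :
    ∃ P ∈ fatPoints, c.x = P.x ∧ c.y = P.y ∧ c.a + c.b < P.mult := by
  simp only [fatPointJets, List.mem_flatMap, List.mem_range] at hc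
  obtain ⟨t, -, P, hP, hc⟩ := hc
  split_ifs at hc with ht
  · simp only [List.mem_map, List.mem_range] at hc
    obtain ⟨a, ha, rfl⟩ := hc
    exact ⟨P, hP, rfl, rfl, by dsimp only; omega⟩
  · exact absurd hc List.not_mem_nil

theorem length_exponents_eq : exponents.length = fatPointJets.length := by decide +kernel

theorem eliminates_fatPointJets :
    eliminates 1009 exponents.length (fatPointJets.map fun c => packRow 1009 c exponents) =
      true := by
  decide +kernel

theorem eq_zero_of_mem_fatPoints {f : MvPolynomial (Fin 2) ℂ} (hdeg : f.totalDegree ≤ 21)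
    (hf : ∀ P ∈ fatPoints, f ∈ ptIdeal (P.x, P.y) ^ P.mult) : f = 0 := by
  have : Fact (Nat.Prime 1009) := ⟨by norm_num⟩
  have hcoeff := coeff_eq_zero_of_eliminates (p := 1009) fatPointJets exponents length_exponents_eq
    (by decide +kernel) eliminates_fatPointJets (fun e => coeff (expVec e) f) fun c hc => by
      obtain ⟨P, hP, hx, hy, hab⟩ := exists_fatPoint_of_mem hc
      exact sum_entry_mul_coeff hdeg c (by rw [hx, hy]; exact hf P hP) hab
  rw [eq_sum_monomial hdeg]
  refine List.sum_eq_zero fun g hg => ?_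
  obtain ⟨e, he, rfl⟩ := List.mem_map.mp hg
  rw [hcoeff e he, map_zero]

end FatPoints

theorem L21_1p2_3_6_7p8_empty :
    ∃ (p : Fin 2 → ℂ × ℂ) (q : ℂ × ℂ) (r : ℂ × ℂ) (s : Fin 8 → ℂ × ℂ),
      ∀ f : MvPolynomial (Fin 2) ℂ, f.totalDegree ≤ 21 →
        (∀ i, f ∈ ptIdeal (p i)) → f ∈ ptIdeal q ^ 3 → f ∈ ptIdeal r ^ 6 → (∀ i, f ∈ ptIdeal (s i) ^ 7) → f = 0 := by
  refine ⟨![(11, 14), (7, 5)], (3, 17), (3, 2), ![(6, 20), (5, 9), (4, 14), (12, 2), (20, 13),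
    (9, 10), (17, 4), (14, 1)], fun f hdeg hp hq hr hs => ?_⟩
  refine FatPoints.eq_zero_of_mem_fatPoints hdeg ?_
  simpa [FatPoints.fatPoints, hq, hr] using
    And.intro (hs 0) ⟨hs 1, hs 2, hs 3, hs 4, hs 5, hs 6, hs 7, hp 0, hp 1⟩
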